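/- arXiv:1906.08081 — 2 statements merged into one kernel-verified Lean document; each statement's English description precedes it below -/
import Mathlib

section
/- Let (V,b) be a finite-dimensional nondegenerate symmetric bilinear space over a field K of characteristic zero. The Laplacian Δ : Sym^d V → Sym^{d-2} V, defined on monomials by Δ(x_1⋯x_d) = Σ_{i<j} b(x_i,x_j) x_1⋯x̂_i⋯x̂_j⋯x_d, is a surjective linear map. -/
open MvPolynomial

/-- The Laplacian contraction operator `Δ = (1/2) Σ_{i,j} B i j ∂_i ∂_j` associated to a
symmetric bilinear form with Gram matrix `B`, acting on `Sym V` modelled as the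
polynomial algebra on a basis of `V`.  On a monomial `x_{a_1}⋯x_{a_d}` it gives
`Σ_{k<l} b(x_{a_k}, x_{a_l}) · x_{a_1}⋯x̂_{a_k}⋯x̂_{a_l}⋯x_{a_d}`. -/
noncomputable def lapOp {K : Type*} [Field K] {n : ℕ} (B : Matrix (Fin n) (Fin n) K) :
    MvPolynomial (Fin n) K →ₗ[K] MvPolynomial (Fin n) K :=
  (1 / 2 : K) • ∑ i, ∑ j, B i j • ((pderiv i).toLinearMap ∘ₗ (pderiv j).toLinearMap)

/-- The power series `∑ a, f (x ^ a) / a! • x ^ a` of a linear functional `f` on polynomials: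
the dual of the polynomial algebra identified with power series through the apolar pairing. -/
noncomputable def apolarSeries {K σ : Type*} [Field K] [Fintype σ] :
    (MvPolynomial σ K →ₗ[K] K) →ₗ[K] MvPowerSeries σ K where
  toFun f a := f (monomial a 1) / ∏ i, ((a i).factorial : K)
  map_add' _ _ := funext fun _ => add_div _ _ _
  map_smul' _ _ := funext fun _ => mul_div_assoc _ _ _

theorem coeff_apolarSeries {K σ : Type*} [Field K] [Fintype σ]
    (f : MvPolynomial σ K →ₗ[K] K) (a : σ →₀ ℕ) :
    MvPowerSeries.coeff a (apolarSeries f) = f (monomial a 1) / ∏ i, ((a i).factorial : K) :=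
  rfl

theorem apolarSeries_injective {K σ : Type*} [Field K] [CharZero K] [Fintype σ] :
    Function.Injective (apolarSeries (K := K) (σ := σ)) := by
  refine (injective_iff_map_eq_zero _).2 fun f hf => ?_
  refine (basisMonomials σ K).ext fun a => ?_
  have h := congrArg (MvPowerSeries.coeff a) hf
  rw [coeff_apolarSeries, map_zero, div_eq_zero_iff] at h
  have h0 : ∏ i, ((a i).factorial : K) ≠ 0 :=
    Finset.prod_ne_zero_iff.2 fun i _ => Nat.cast_ne_zero.2 (Nat.factorial_ne_zero _)
  simpa using h.resolve_right h0

theorem apolarSeries_comp_pderiv {K σ : Type*} [Field K] [CharZero K] [Fintype σ]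
    (f : MvPolynomial σ K →ₗ[K] K) (i : σ) :
    apolarSeries (f ∘ₗ (pderiv i).toLinearMap) = MvPowerSeries.X i * apolarSeries f := by
  classical
  ext a
  rw [coeff_apolarSeries, MvPowerSeries.X, MvPowerSeries.coeff_monomial_mul, one_mul]
  simp only [LinearMap.comp_apply, Derivation.coeFn_coe,
    pderiv_monomial, one_mul]
  split_ifs with h
  · obtain ⟨b, rfl⟩ : ∃ b : σ →₀ ℕ, a = b + Finsupp.single i 1 := le_iff_exists_add'.1 h
    rw [add_tsub_cancel_right, coeff_apolarSeries, ← mul_one (((b + _) i : ℕ) : K),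
      ← smul_eq_mul, ← smul_monomial, map_smul, smul_eq_mul,
      ← Finset.mul_prod_erase _ _ (Finset.mem_univ i),
      ← Finset.mul_prod_erase _ (fun j => ((b j).factorial : K)) (Finset.mem_univ i)]
    have hprod : ∏ j ∈ Finset.univ.erase i, (((b + Finsupp.single i 1 : σ →₀ ℕ) j).factorial : K) =
        ∏ j ∈ Finset.univ.erase i, ((b j).factorial : K) :=
      Finset.prod_congr rfl fun j hj => by
        simp [Finsupp.single_eq_of_ne (Finset.ne_of_mem_erase hj)]
    have hi : (((b + Finsupp.single i 1 : σ →₀ ℕ) i : ℕ) : K) ≠ 0 := by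
      simpa using Nat.cast_add_one_ne_zero (R := K) (b i)
    have hfac : (((b + Finsupp.single i 1 : σ →₀ ℕ) i).factorial : K) =
        ((b + Finsupp.single i 1 : σ →₀ ℕ) i : ℕ) * ((b i).factorial : K) := by
      simp [Nat.factorial_succ]
    rw [hprod, hfac, mul_assoc, mul_div_mul_left _ _ hi]
  · have : a i = 0 := by
      simpa [Finsupp.single_le_iff, Nat.one_le_iff_ne_zero] using h
    simp [this]

theorem apolarSeries_comp_lapOp {K : Type*} [Field K] [CharZero K] {n : ℕ}
    (B : Matrix (Fin n) (Fin n) K) (f : MvPolynomial (Fin n) K →ₗ[K] K) :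
    apolarSeries (f ∘ₗ lapOp B) =
      ((1 / 2 : K) • ∑ i, ∑ j, B i j • (MvPowerSeries.X j * MvPowerSeries.X i)) *
        apolarSeries f := by
  have h (i j : Fin n) : apolarSeries (f ∘ₗ ((pderiv i).toLinearMap ∘ₗ (pderiv j).toLinearMap)) =
      MvPowerSeries.X j * MvPowerSeries.X i * apolarSeries f := by
    rw [← LinearMap.comp_assoc, apolarSeries_comp_pderiv, apolarSeries_comp_pderiv, mul_assoc]
  have hsum : f ∘ₗ lapOp B = (1 / 2 : K) • ∑ i, ∑ j,
      B i j • (f ∘ₗ ((pderiv i).toLinearMap ∘ₗ (pderiv j).toLinearMap)) :=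
    LinearMap.ext fun p => by simp [lapOp, LinearMap.sum_apply]
  simp only [hsum, map_smul, map_sum, h, smul_mul_assoc, Finset.sum_mul]

theorem lapOp_X_mul_X {K : Type*} [Field K] [CharZero K] {n : ℕ} {B : Matrix (Fin n) (Fin n) K}
    (hsym : ∀ i j, B i j = B j i) (k l : Fin n) :
    lapOp B (X k * X l) = C (B k l) := by
  have h (i j : Fin n) : pderiv i (pderiv j (X k * X l : MvPolynomial (Fin n) K)) =
      C ((if i = k then if j = l then 1 else 0 else 0) +
        if i = l then if j = k then 1 else 0 else 0) := by
    simp only [pderiv_mul, pderiv_X, Pi.single_apply, map_add, eq_comm (a := k), eq_comm (a := l)]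
    split_ifs <;> simp_all
  simp only [lapOp, LinearMap.smul_apply, LinearMap.sum_apply, LinearMap.comp_apply,
    Derivation.coeFn_coe, h, smul_eq_C_mul, ← C_mul, ← map_sum]
  simp only [mul_add, mul_ite, mul_one, mul_zero, Finset.sum_add_distrib, Finset.sum_ite_irrel,
    Finset.sum_ite_eq', Finset.sum_const_zero, Finset.mem_univ, if_true, hsym l k]
  congr 1
  ring

theorem lapOp_surjective {K : Type*} [Field K] [CharZero K] {n : ℕ} {B : Matrix (Fin n) (Fin n) K}
    (hsym : ∀ i j, B i j = B j i) (hB : B ≠ 0) : Function.Surjective (lapOp B) := by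
  rw [← LinearMap.dualMap_injective_iff,
    injective_iff_map_eq_zero]
  intro f hf
  have h := apolarSeries_comp_lapOp B f
  rw [show f ∘ₗ lapOp B = 0 from hf, map_zero, eq_comm, mul_eq_zero] at h
  refine apolarSeries_injective ((h.resolve_left fun hQ => hB ?_).trans (map_zero _).symm)
  ext k l
  have h' := apolarSeries_comp_lapOp B (lcoeff K 0)
  rw [hQ, zero_mul, ← map_zero (apolarSeries (K := K))] at h'
  have hkl := LinearMap.congr_fun (apolarSeries_injective h') (X k * X l)
  rw [LinearMap.comp_apply, lapOp_X_mul_X hsym] at hkl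
  simpa using hkl

theorem lapOp_homogeneousComponent {K : Type*} [Field K] {n d : ℕ} (hd : 2 ≤ d)
    (B : Matrix (Fin n) (Fin n) K) (p : MvPolynomial (Fin n) K) :
    lapOp B (homogeneousComponent d p) = homogeneousComponent (d - 2) (lapOp B p) := by
  ext a
  have h (i j : Fin n) :
      coeff a (pderiv i (pderiv j (homogeneousComponent d p))) =
        if a.degree = d - 2 then coeff a (pderiv i (pderiv j p)) else 0 := by
    have hdeg : (a + Finsupp.single i 1 + Finsupp.single j 1).degree = d ↔ a.degree = d - 2 := by
      simp only [map_add, Finsupp.degree_single]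
      omega
    simp only [coeff_pderiv, coeff_homogeneousComponent, hdeg, ite_mul, zero_mul]
  simp only [lapOp, LinearMap.smul_apply, LinearMap.sum_apply, LinearMap.comp_apply,
    Derivation.coeFn_coe, coeff_homogeneousComponent, coeff_smul, coeff_sum, h]
  split_ifs <;> simp

/-- For a finite-dimensional nondegenerate symmetric bilinear space over a
field of characteristic zero, the Laplacian `Δ : Sym^d V → Sym^{d-2} V` is surjective. -/
theorem stmt5 {K : Type*} [Field K] [CharZero K] {n d : ℕ} (hn : 0 < n) (hd : 2 ≤ d)
    (B : Matrix (Fin n) (Fin n) K) (hsym : ∀ i j, B i j = B j i)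
    (hnd : IsUnit B.det) :
    ∀ q : MvPolynomial (Fin n) K, q.IsHomogeneous (d - 2) →
      ∃ p : MvPolynomial (Fin n) K, p.IsHomogeneous d ∧ lapOp B p = q := by
  intro q hq
  have hB : B ≠ 0 := by
    rintro rfl
    have : Nonempty (Fin n) := ⟨⟨0, hn⟩⟩
    simp at hnd
  obtain ⟨p, rfl⟩ := lapOp_surjective hsym hB q
  refine ⟨homogeneousComponent d p, homogeneousComponent_isHomogeneous d p, ?_⟩
  rw [lapOp_homogeneousComponent hd, homogeneousComponent_of_mem hq, if_pos rfl]
end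

section
/- Let V be a finite-dimensional nondegenerate symmetric bilinear space over a field K of characteristic zero, of dimension at least 3, and let d ≥ 1. Any element of GL(Sym^d V) that commutes with the image of so(V,b) acting on Sym^{[d]}V := ker(Δ : Sym^d V → Sym^{d-2} V) and preserves the form b_[d] restricted to Sym^{[d]}V acts on Sym^{[d]}V as multiplication by +1 or -1. -/
open MvPolynomial Matrix

/-- The derivation action on `Sym V` of an endomorphism of `V` with matrix `A`. -/
noncomputable def soOp {K : Type*} [Field K] {n : ℕ} (A : Matrix (Fin n) (Fin n) K) :
    MvPolynomial (Fin n) K →ₗ[K] MvPolynomial (Fin n) K :=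
  ∑ i, ∑ j, A i j • (LinearMap.mulLeft K (X i) ∘ₗ (pderiv j).toLinearMap)

/-- `Sym^{[d]} V`: the harmonic part, i.e. the homogeneous degree-`d` polynomials killed
by the Laplacian `Δ`. -/
noncomputable def harm {K : Type*} [Field K] {n : ℕ} (B : Matrix (Fin n) (Fin n) K)
    (d : ℕ) : Submodule K (MvPolynomial (Fin n) K) where
  carrier := {p | p.IsHomogeneous d ∧ lapOp B p = 0}
  add_mem' := by
    intro p q hp hq
    exact ⟨hp.1.add hq.1, by simp [map_add, hp.2, hq.2]⟩
  zero_mem' := ⟨isHomogeneous_zero _ _ _, map_zero _⟩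
  smul_mem' := by
    intro c p hp
    refine ⟨?_, by rw [_root_.map_smul, hp.2, smul_zero]⟩
    have h0 := (isHomogeneous_C (Fin n) c).mul hp.1
    rw [zero_add] at h0
    simpa [smul_eq_C_mul] using h0

/-- The contraction operators `L_i = Σ_j B i j ∂_j`. -/
noncomputable def lop {K : Type*} [Field K] {n : ℕ} (B : Matrix (Fin n) (Fin n) K)
    (i : Fin n) : Module.End K (MvPolynomial (Fin n) K) :=
  ∑ j, B i j • (pderiv j).toLinearMap

/-- The induced bilinear form `b_[d]` on `Sym^d V`:
`b_[d](p, q) = (-1)^d · constant coefficient of q(L)·p`, which on monomials equals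
`(-1)^d Σ_{σ ∈ S_d} Π_i b(x_i, y_{σ(i)})`. -/
noncomputable def bd {K : Type*} [Field K] {n : ℕ} (B : Matrix (Fin n) (Fin n) K)
    (d : ℕ) (p q : MvPolynomial (Fin n) K) : K :=
  (-1 : K) ^ d *
    constantCoeff (∑ m ∈ q.support,
      q.coeff m • ((List.ofFn fun i : Fin n => (lop B i) ^ m i).prod p))

section Contraction

variable {K : Type*} [Field K] {n : ℕ}

theorem pderiv_pderiv_comm (i j : Fin n) (p : MvPolynomial (Fin n) K) :
    pderiv i (pderiv j p) = pderiv j (pderiv i p) := by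
  have h : ⁅pderiv (R := K) i, pderiv (R := K) j⁆ = 0 := by
    refine MvPolynomial.derivation_ext fun k => ?_
    rw [Derivation.commutator_apply]
    by_cases h1 : k = i <;> by_cases h2 : k = j <;> simp [pderiv_X, Pi.single_apply, h1, h2]
    all_goals split_ifs <;> simp
  have h2 := DFunLike.congr_fun h p
  rw [Derivation.commutator_apply] at h2
  exact sub_eq_zero.mp h2

theorem lop_apply (B : Matrix (Fin n) (Fin n) K) (i : Fin n) (p : MvPolynomial (Fin n) K) :
    lop B i p = ∑ j, B i j • pderiv j p := by
  simp [lop, LinearMap.sum_apply]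

theorem lapOp_apply (B : Matrix (Fin n) (Fin n) K) (p : MvPolynomial (Fin n) K) :
    lapOp B p = (1 / 2 : K) • ∑ i, ∑ j, B i j • pderiv i (pderiv j p) := by
  simp [lapOp, LinearMap.sum_apply]

theorem soOp_apply (A : Matrix (Fin n) (Fin n) K) (p : MvPolynomial (Fin n) K) :
    soOp A p = ∑ i, ∑ j, A i j • (X i * pderiv j p) := by
  simp [soOp, LinearMap.sum_apply]

theorem lop_commute (B : Matrix (Fin n) (Fin n) K) (i j : Fin n) :
    lop B i * lop B j = lop B j * lop B i := by
  refine LinearMap.ext fun p => ?_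
  simp only [Module.End.mul_apply, lop_apply, map_sum, Derivation.map_smul]
  rw [Finset.sum_comm]
  refine Finset.sum_congr rfl fun k _ => Finset.sum_congr rfl fun l _ => ?_
  rw [pderiv_pderiv_comm, smul_comm]

/-- Substituting the commuting contraction operators for the variables. -/
theorem exists_contraction (B : Matrix (Fin n) (Fin n) K) :
    ∃ θ : MvPolynomial (Fin n) K →ₐ[K] Module.End K (MvPolynomial (Fin n) K),
      ∀ i, θ (X i) = lop B i := by
  have hc : ∀ a ∈ Set.range (lop B), ∀ b ∈ Set.range (lop B), a * b = b * a := by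
    rintro _ ⟨i, rfl⟩ _ ⟨j, rfl⟩
    exact lop_commute B i j
  have hm := Algebra.isMulCommutative_adjoin K hc
  let _ : CommRing (Algebra.adjoin K (Set.range (lop B))) :=
    { (Algebra.adjoin K (Set.range (lop B))).toRing with mul_comm := hm.is_comm.comm }
  refine ⟨(Algebra.adjoin K (Set.range (lop B))).val.comp
    (aeval (S₁ := Algebra.adjoin K (Set.range (lop B)))
      fun i => ⟨lop B i, Algebra.subset_adjoin ⟨i, rfl⟩⟩), fun i => ?_⟩
  simp

theorem bd_eq {B : Matrix (Fin n) (Fin n) K}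
    {θ : MvPolynomial (Fin n) K →ₐ[K] Module.End K (MvPolynomial (Fin n) K)}
    (hθ : ∀ i, θ (X i) = lop B i) (d : ℕ) (p q : MvPolynomial (Fin n) K) :
    bd B d p q = (-1) ^ d * constantCoeff (θ q p) := by
  have hm : ∀ m : Fin n →₀ ℕ,
      θ (monomial m 1) = (List.ofFn fun i : Fin n => (lop B i) ^ m i).prod := by
    intro m
    rw [monomial_eq, C_1, one_mul, Finsupp.prod_fintype _ _ (by simp), ← List.prod_ofFn,
      map_list_prod, List.map_ofFn]
    congr 2
    funext i
    simp [hθ]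
  rw [bd]
  congr 2
  conv_rhs => rw [q.as_sum, map_sum, LinearMap.sum_apply]
  refine Finset.sum_congr rfl fun m _ => ?_
  rw [← hm, ← mul_one (coeff m q), ← smul_eq_mul, ← smul_monomial, map_smul, LinearMap.smul_apply]
  simp

end Contraction

section Diagonal

variable {K : Type*} [Field K] {n : ℕ} (N : Fin n → K)

/-- The infinitesimal rotation in the coordinate plane `(i, j)`. -/
noncomputable def rot (i j : Fin n) :
    Derivation K (MvPolynomial (Fin n) K) (MvPolynomial (Fin n) K) :=
  N j • (X i : MvPolynomial (Fin n) K) • pderiv j - N i • (X j : MvPolynomial (Fin n) K) • pderiv i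

theorem rot_apply (i j : Fin n) (p : MvPolynomial (Fin n) K) :
    rot N i j p = N j • (X i * pderiv j p) - N i • (X j * pderiv i p) := by
  simp [rot]

/-- The quadratic form dual to the Laplacian. -/
noncomputable def quad : MvPolynomial (Fin n) K :=
  (1 / 2 : K) • ∑ i, (N i)⁻¹ • (X i * X i)

theorem exists_soOp_eq_rot (i j : Fin n) :
    ∃ A : Matrix (Fin n) (Fin n) K, A.transpose * diagonal N + diagonal N * A = 0 ∧
      ∀ p, soOp A p = rot N i j p := by
  refine ⟨Matrix.single i j (N j) - Matrix.single j i (N i), ?_, fun p => ?_⟩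
  · ext a b
    simp [Matrix.mul_diagonal, Matrix.diagonal_mul, Matrix.single_apply, sub_mul, mul_sub]
    grind
  · rw [soOp_apply, rot_apply]
    simp [Matrix.single_apply, sub_smul, Finset.sum_sub_distrib, ite_and, ite_smul]

theorem lapOp_diagonal (p : MvPolynomial (Fin n) K) :
    lapOp (diagonal N) p = (1 / 2 : K) • ∑ i, N i • pderiv i (pderiv i p) := by
  simp [lapOp_apply, diagonal_apply]

theorem lapOp_pderiv (B : Matrix (Fin n) (Fin n) K) (i : Fin n) (p : MvPolynomial (Fin n) K) :
    lapOp B (pderiv i p) = pderiv i (lapOp B p) := by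
  simp only [lapOp_apply, Derivation.map_smul, map_sum]
  simp only [pderiv_pderiv_comm i]

theorem lapOp_X_mul [CharZero K] (i : Fin n) (p : MvPolynomial (Fin n) K) :
    lapOp (diagonal N) (X i * p) = X i * lapOp (diagonal N) p + N i • pderiv i p := by
  have h : ∀ j, pderiv j (pderiv j (X i * p)) =
      X i * pderiv j (pderiv j p) + if i = j then (2 : K) • pderiv i p else 0 := by
    intro j
    by_cases hij : i = j
    · subst hij
      simp [two_smul]
      ring
    · simp [pderiv_X_of_ne hij, hij]
  simp only [lapOp_diagonal, h, smul_add, Finset.sum_add_distrib, smul_ite, smul_zero,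
    Finset.sum_ite_eq, Finset.mem_univ, if_true, mul_smul_comm, Finset.mul_sum]
  congr 1
  rw [smul_smul, smul_smul]
  congr 1
  field_simp

theorem lapOp_rot [CharZero K] (i j : Fin n) (p : MvPolynomial (Fin n) K) :
    lapOp (diagonal N) (rot N i j p) = rot N i j (lapOp (diagonal N) p) := by
  simp only [rot_apply, map_sub, map_smul, lapOp_X_mul, lapOp_pderiv, smul_add]
  rw [pderiv_pderiv_comm i j, smul_comm (N i) (N j)]
  abel

variable {N}

theorem rot_quad (hN : ∀ i, N i ≠ 0) [CharZero K] (i j : Fin n) : rot N i j (quad N) = 0 := by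
  have h : ∀ k, pderiv k (quad N) = (N k)⁻¹ • X k := by
    intro k
    have h1 : ∀ l, pderiv k (X l * X l : MvPolynomial (Fin n) K) =
        if l = k then (2 : K) • X k else 0 := by
      intro l
      by_cases hlk : l = k
      · subst hlk; simp [two_smul]
      · simp [pderiv_X_of_ne hlk, hlk]
    simp only [quad, Derivation.map_smul, map_sum, h1, smul_ite, smul_zero, Finset.sum_ite_eq',
      Finset.mem_univ, if_true, smul_smul]
    congr 1
    field_simp
  rw [rot_apply, h, h]
  simp [smul_smul, hN, mul_comm (X i)]

theorem lapOp_quad_mul [CharZero K] (hN : ∀ i, N i ≠ 0) {m : ℕ} {p : MvPolynomial (Fin n) K}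
    (hp : p.IsHomogeneous m) :
    lapOp (diagonal N) (quad N * p) =
      quad N * lapOp (diagonal N) p + ((n : K) / 2 + m) • p := by
  have h : ∀ i, (N i)⁻¹ • lapOp (diagonal N) (X i * (X i * p)) =
      (N i)⁻¹ • (X i * X i * lapOp (diagonal N) p) + (p + (2 : K) • (X i * pderiv i p)) := by
    intro i
    rw [lapOp_X_mul, lapOp_X_mul, smul_add, mul_add, smul_add, pderiv_mul,
      pderiv_X_self]
    simp only [mul_smul_comm, smul_smul, inv_mul_cancel₀ (hN i), one_smul, two_smul, mul_assoc]
    ring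
  have he := hp.sum_X_mul_pderiv
  rw [quad, smul_mul_assoc, map_smul, Finset.sum_mul, map_sum]
  simp only [smul_mul_assoc, map_smul, mul_assoc (X _) (X _) p, h, Finset.sum_add_distrib,
    ← Finset.smul_sum, he, Finset.sum_mul]
  simp only [Finset.sum_const, Finset.card_univ, Fintype.card_fin, smul_add, smul_smul,
    ← Nat.cast_smul_eq_nsmul K, add_smul]
  congr 3
  · ring
  · field_simp

theorem isHomogeneous_lapOp (B : Matrix (Fin n) (Fin n) K) {m : ℕ} {p : MvPolynomial (Fin n) K}
    (hp : p.IsHomogeneous (m + 2)) : (lapOp B p).IsHomogeneous m := by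
  rw [lapOp_apply]
  have h : ∀ i j, (pderiv i (pderiv j p)).IsHomogeneous m := fun i j => hp.pderiv.pderiv
  refine (homogeneousSubmodule (Fin n) K m).smul_mem _ (Submodule.sum_mem _ fun i _ =>
    Submodule.sum_mem _ fun j _ => Submodule.smul_mem _ _ (h i j))

theorem pderiv_eq_zero_of_isHomogeneous_zero {p : MvPolynomial (Fin n) K}
    (hp : p.IsHomogeneous 0) (i : Fin n) : pderiv i p = 0 := by
  rw [← totalDegree_zero_iff_isHomogeneous, totalDegree_eq_zero_iff_eq_C] at hp
  rw [hp, pderiv_C]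

theorem lapOp_eq_zero_of_lt_two (B : Matrix (Fin n) (Fin n) K) {m : ℕ} (hm : m < 2)
    {p : MvPolynomial (Fin n) K} (hp : p.IsHomogeneous m) : lapOp B p = 0 := by
  have h : ∀ i j, pderiv i (pderiv j p) = 0 := fun i j =>
    pderiv_eq_zero_of_isHomogeneous_zero (by
      have := hp.pderiv (i := j)
      rwa [show m - 1 = 0 by lia] at this) i
  simp [lapOp_apply, h]

theorem isHomogeneous_quad : (quad N).IsHomogeneous 2 := by
  refine (homogeneousSubmodule (Fin n) K 2).smul_mem _ (Submodule.sum_mem _ fun i _ =>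
    Submodule.smul_mem _ _ ?_)
  exact (isHomogeneous_X K i).mul (isHomogeneous_X K i)

/-- `quad * Δ + x / 2` is surjective on homogeneous polynomials invariant under rotations
fixing the coordinate `i₀`. -/
theorem exists_quad_mul_lapOp_add [CharZero K] (hN : ∀ i, N i ≠ 0) (i₀ : Fin n) (m : ℕ) :
    ∀ x : ℕ, 1 ≤ x → ∀ h : MvPolynomial (Fin n) K, h.IsHomogeneous m →
      (∀ i j, i ≠ i₀ → j ≠ i₀ → rot N i j h = 0) →
      ∃ s : MvPolynomial (Fin n) K, s.IsHomogeneous m ∧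
        (∀ i j, i ≠ i₀ → j ≠ i₀ → rot N i j s = 0) ∧
        quad N * lapOp (diagonal N) s + ((x : K) / 2) • s = h := by
  induction m using Nat.strong_induction_on with
  | _ m ih =>
    intro x hx h hh hinv
    have hx0 : (x : K) / 2 ≠ 0 := by
      have : (x : K) ≠ 0 := by exact_mod_cast (by lia : x ≠ 0)
      exact div_ne_zero this two_ne_zero
    by_cases hm : m < 2
    · have hs : (((x : K) / 2)⁻¹ • h).IsHomogeneous m :=
        (homogeneousSubmodule (Fin n) K m).smul_mem _ hh
      refine ⟨_, hs, fun i j hi hj => by rw [Derivation.map_smul, hinv i j hi hj, smul_zero], ?_⟩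
      rw [lapOp_eq_zero_of_lt_two _ hm hs, mul_zero, zero_add, smul_inv_smul₀ hx0]
    · obtain ⟨k, rfl⟩ : ∃ k, m = k + 2 := ⟨m - 2, by lia⟩
      obtain ⟨t, ht, htinv, hteq⟩ := ih k (by lia) (x + n + 2 * k) (by lia)
        (lapOp (diagonal N) h) (isHomogeneous_lapOp _ hh)
        (fun i j hi hj => by rw [← lapOp_rot, hinv i j hi hj, map_zero])
      have hQ : (quad N * t).IsHomogeneous (k + 2) := by
        rw [add_comm]
        exact isHomogeneous_quad.mul ht
      refine ⟨((x : K) / 2)⁻¹ • (h - quad N * t),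
        (homogeneousSubmodule (Fin n) K _).smul_mem _ (hh.sub hQ), fun i j hi hj => ?_, ?_⟩
      · rw [Derivation.map_smul, map_sub, Derivation.leibniz, hinv i j hi hj, htinv i j hi hj,
          rot_quad hN]
        simp
      · rw [map_smul, map_sub, lapOp_quad_mul hN ht, ← hteq, smul_inv_smul₀ hx0]
        have : quad N * lapOp (diagonal N) t + (((x + n + 2 * k : ℕ) : K) / 2) • t -
            (quad N * lapOp (diagonal N) t + ((n : K) / 2 + k) • t) = ((x : K) / 2) • t := by
          rw [add_sub_add_left_eq_sub, ← sub_smul]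
          congr 1
          push_cast
          ring
        rw [this, inv_smul_smul₀ hx0]
        ring

/-- Existence of a zonal harmonic congruent to `X i₀ ^ d` modulo the quadratic form. -/
theorem exists_zonal [CharZero K] (hN : ∀ i, N i ≠ 0) (i₀ : Fin n) (d : ℕ) :
    ∃ Z ∈ harm (diagonal N) d, (∀ i j, i ≠ i₀ → j ≠ i₀ → rot N i j Z = 0) ∧
      ∃ s, Z = X i₀ ^ d - quad N * s := by
  have hX : (X i₀ ^ d : MvPolynomial (Fin n) K).IsHomogeneous d := by
    simpa using (isHomogeneous_X K i₀).pow d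
  have hXinv : ∀ i j, i ≠ i₀ → j ≠ i₀ → rot N i j (X i₀ ^ d) = 0 := by
    intro i j hi hj
    rw [rot_apply, pderiv_pow, pderiv_pow, pderiv_X_of_ne hi.symm, pderiv_X_of_ne hj.symm]
    simp
  by_cases hd : d < 2
  · exact ⟨X i₀ ^ d, ⟨hX, lapOp_eq_zero_of_lt_two _ hd hX⟩, hXinv, 0, by simp⟩
  · obtain ⟨k, rfl⟩ : ∃ k, d = k + 2 := ⟨d - 2, by lia⟩
    obtain ⟨s, hs, hsinv, hseq⟩ := exists_quad_mul_lapOp_add hN i₀ k (n + 2 * k)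
      (by have := i₀.pos; lia) (lapOp (diagonal N) (X i₀ ^ (k + 2))) (isHomogeneous_lapOp _ hX)
      (fun i j hi hj => by rw [← lapOp_rot, hXinv i j hi hj, map_zero])
    have hQ : (quad N * s).IsHomogeneous (k + 2) := by
      rw [add_comm]
      exact isHomogeneous_quad.mul hs
    refine ⟨X i₀ ^ (k + 2) - quad N * s, ⟨hX.sub hQ, ?_⟩, fun i j hi hj => ?_, s, rfl⟩
    · rw [map_sub, lapOp_quad_mul hN hs, ← hseq]
      have : ((n + 2 * k : ℕ) : K) / 2 = n / 2 + k := by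
        push_cast
        ring
      rw [this, sub_self]
    · rw [map_sub, hXinv i j hi hj, Derivation.leibniz, hsinv i j hi hj, rot_quad hN]
      simp

theorem coeff_add_single_X_mul (i : Fin n) (μ : Fin n →₀ ℕ) (p : MvPolynomial (Fin n) K) :
    coeff (μ + Finsupp.single i 1) (X i * p) = coeff μ p := by
  rw [add_comm, coeff_X_mul]

theorem coeff_X_mul_of_eq_zero {i : Fin n} {μ : Fin n →₀ ℕ} (h : μ i = 0)
    (p : MvPolynomial (Fin n) K) : coeff μ (X i * p) = 0 := by
  rw [coeff_X_mul', if_neg (by simp [h])]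

theorem exists_eq_add_single {m : Fin n →₀ ℕ} {i : Fin n} (h : m i ≠ 0) :
    ∃ μ, m = μ + Finsupp.single i 1 :=
  ⟨m - Finsupp.single i 1, by
    rw [tsub_add_cancel_of_le]
    rw [Finsupp.single_le_iff]
    lia⟩

theorem exists_ne_of_ne_single {m : Fin n →₀ ℕ} {i₀ : Fin n} {d : ℕ} (hm : m.degree = d)
    (h : m ≠ Finsupp.single i₀ d) : ∃ i, i ≠ i₀ ∧ m i ≠ 0 := by
  by_contra! hc
  have h1 : m = Finsupp.single i₀ (m i₀) := by
    ext i
    by_cases hi : i = i₀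
    · subst hi; simp
    · rw [hc i hi, Finsupp.single_eq_of_ne hi]
  rw [h1, Finsupp.degree_single] at hm
  exact h (hm ▸ h1)

/-- A harmonic polynomial invariant under rotations fixing the coordinate `i₀` vanishes as soon
as its coefficient of `X i₀ ^ d` does. -/
theorem eq_zero_of_rot_eq_zero [CharZero K] (hn : 3 ≤ n) (hN : ∀ i, N i ≠ 0) {i₀ : Fin n} {d : ℕ}
    {f : MvPolynomial (Fin n) K} (hf : f ∈ harm (diagonal N) d)
    (hinv : ∀ i j, i ≠ i₀ → j ≠ i₀ → rot N i j f = 0)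
    (h0 : coeff (Finsupp.single i₀ d) f = 0) : f = 0 := by
  have key : ∀ s : ℕ, ∀ m : Fin n →₀ ℕ, m.degree = d → d ≤ m i₀ + s → coeff m f = 0 := by
    intro s
    induction s with
    | zero =>
      intro m hm hs
      by_cases hms : m = Finsupp.single i₀ d
      · rw [hms, h0]
      · obtain ⟨i, hi, hmi⟩ := exists_ne_of_ne_single hm hms
        obtain ⟨μ, rfl⟩ := exists_eq_add_single hmi
        have := Finsupp.le_degree i₀ μ
        simp [Finsupp.single_eq_of_ne hi.symm] at hm hs
        lia
    | succ s ih =>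
      intro m hm hs
      by_cases hms : m = Finsupp.single i₀ d
      · rw [hms, h0]
      by_cases h2 : ∃ i, i ≠ i₀ ∧ 2 ≤ m i
      · obtain ⟨i, hi, hmi⟩ := h2
        obtain ⟨μ', rfl⟩ := exists_eq_add_single (m := m) (i := i) (by lia)
        obtain ⟨μ, rfl⟩ := exists_eq_add_single (m := μ') (i := i) (by simp at hmi; lia)
        have ht : ∀ k, k ≠ i₀ →
            N k * (coeff (μ + Finsupp.single k 1 + Finsupp.single k 1) f * (μ k + 1 + 1)) =
            N i * (coeff (μ + Finsupp.single i 1 + Finsupp.single i 1) f * (μ i + 1 + 1)) := by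
          intro k hk
          have h := congrArg (coeff (μ + Finsupp.single k 1 + Finsupp.single i 1)) (hinv i k hi hk)
          rw [rot_apply, coeff_sub, coeff_smul, coeff_smul, coeff_add_single_X_mul,
            add_right_comm, coeff_add_single_X_mul, coeff_pderiv, coeff_pderiv] at h
          simpa [sub_eq_zero] using h
        have hl := congrArg (coeff μ) hf.2
        rw [lapOp_diagonal] at hl
        simp only [coeff_smul, coeff_sum, coeff_pderiv, smul_eq_mul, coeff_zero, mul_eq_zero,
          one_div, inv_eq_zero, OfNat.ofNat_ne_zero, false_or, Finsupp.add_apply,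
          Finsupp.single_eq_same] at hl
        rw [← Finset.add_sum_erase _ _ (Finset.mem_univ i₀), ih _ (by simpa using hm) (by
          simp [Finsupp.single_eq_of_ne hi.symm] at hs ⊢
          lia)] at hl
        have hsum : (N i * (coeff (μ + Finsupp.single i 1 + Finsupp.single i 1) f * (μ i + 1 + 1))) *
            ((∑ k ∈ Finset.univ.erase i₀, (μ k + 1) : ℕ) : K) = 0 := by
          rw [Nat.cast_sum, Finset.mul_sum, ← hl]
          simp only [zero_mul, mul_zero, zero_add]
          refine Finset.sum_congr rfl fun k hk => ?_
          rw [← ht k (Finset.ne_of_mem_erase hk)]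
          push_cast
          ring
        have hpos : ((∑ k ∈ Finset.univ.erase i₀, (μ k + 1) : ℕ) : K) ≠ 0 := by
          rw [Nat.cast_ne_zero, ← Nat.pos_iff_ne_zero]
          exact Finset.sum_pos (fun _ _ => Nat.succ_pos _) ⟨i, by simp [hi]⟩
        have hi2 : (μ i + 1 + 1 : K) ≠ 0 := by exact_mod_cast Nat.succ_ne_zero (μ i + 1)
        simpa [hN i, hi2] using (mul_eq_zero.mp hsum).resolve_right hpos
      · push Not at h2
        obtain ⟨j, hj, hmj⟩ := exists_ne_of_ne_single hm hms
        have hj2 := h2 j hj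
        obtain ⟨μ, rfl⟩ := exists_eq_add_single hmj
        obtain ⟨i, hi⟩ : ∃ i, i ∉ ({i₀, j} : Finset (Fin n)) := by
          by_contra! hc
          have := Finset.card_le_card (fun i _ => hc i : Finset.univ ⊆ ({i₀, j} : Finset (Fin n)))
          have h3 := Finset.card_le_two (a := i₀) (b := j)
          simp only [Finset.card_univ, Fintype.card_fin] at this
          lia
        simp only [Finset.mem_insert, Finset.mem_singleton, not_or] at hi
        have hμ : μ j = 0 := by simp at hj2; lia
        have h := congrArg (coeff (μ + Finsupp.single i 1)) (hinv i j hi.1 hj)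
        rw [rot_apply, coeff_sub, coeff_smul, coeff_smul, coeff_add_single_X_mul, coeff_pderiv,
          coeff_X_mul_of_eq_zero (by simp [hμ, Finsupp.single_eq_of_ne (Ne.symm hi.2)])] at h
        simpa [hμ, hN j] using h
  ext m
  rw [coeff_zero]
  by_cases hm : m.degree = d
  · exact key d m hm (by lia)
  · exact hf.1.coeff_eq_zero hm

/-- A space of homogeneous polynomials stable under rotations on which the coefficient of
`X i₀ ^ d` vanishes is zero. -/
theorem eq_zero_of_rot_mem [CharZero K] (hN : ∀ i, N i ≠ 0) {i₀ : Fin n} {d : ℕ}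
    (W : Submodule K (MvPolynomial (Fin n) K)) (hW : ∀ r ∈ W, r.IsHomogeneous d)
    (hrot : ∀ r ∈ W, ∀ j, rot N i₀ j r ∈ W)
    (h0 : ∀ r ∈ W, coeff (Finsupp.single i₀ d) r = 0) {r : MvPolynomial (Fin n) K}
    (hr : r ∈ W) : r = 0 := by
  have key : ∀ s : ℕ, ∀ r ∈ W, ∀ m : Fin n →₀ ℕ, m.degree = d → d ≤ m i₀ + s →
      coeff m r = 0 := by
    intro s
    induction s with
    | zero =>
      intro r hr m hm hs
      by_cases hms : m = Finsupp.single i₀ d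
      · rw [hms, h0 r hr]
      · obtain ⟨i, hi, hmi⟩ := exists_ne_of_ne_single hm hms
        obtain ⟨μ, rfl⟩ := exists_eq_add_single hmi
        have := Finsupp.le_degree i₀ μ
        simp [Finsupp.single_eq_of_ne hi.symm] at hm hs
        lia
    | succ s ih =>
      intro r hr m hm hs
      by_cases hms : m = Finsupp.single i₀ d
      · rw [hms, h0 r hr]
      obtain ⟨j, hj, hmj⟩ := exists_ne_of_ne_single hm hms
      obtain ⟨μ, rfl⟩ := exists_eq_add_single hmj
      simp [Finsupp.single_eq_of_ne hj.symm] at hm hs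
      have h := ih _ (hrot r hr j) (μ + Finsupp.single i₀ 1) (by simpa using hm) (by
        simp; lia)
      have h2 : coeff (μ + Finsupp.single i₀ 1) (X j * pderiv i₀ r) = 0 := by
        by_cases hμ : μ j = 0
        · exact coeff_X_mul_of_eq_zero (by simp [hμ, Finsupp.single_eq_of_ne hj]) _
        · obtain ⟨ν, rfl⟩ := exists_eq_add_single hμ
          rw [add_right_comm, coeff_add_single_X_mul, coeff_pderiv,
            ih r hr _ (by simpa using hm) (by
              simp [Finsupp.single_eq_of_ne hj.symm] at hs ⊢; lia), zero_mul]
      have hj1 : (μ j + 1 : K) ≠ 0 := by exact_mod_cast Nat.succ_ne_zero (μ j)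
      rw [rot_apply, coeff_sub, coeff_smul, coeff_smul, h2, coeff_add_single_X_mul,
        coeff_pderiv] at h
      simpa [hN j, hj1] using h
  ext m
  rw [coeff_zero]
  by_cases hm : m.degree = d
  · exact key d r hr m hm (by lia)
  · exact (hW r hr).coeff_eq_zero hm

theorem lop_diagonal (i : Fin n) (p : MvPolynomial (Fin n) K) :
    lop (diagonal N) i p = N i • pderiv i p := by
  simp [lop_apply, diagonal_apply]

theorem constantCoeff_lop_pow (i : Fin n) (k : ℕ) :
    ∀ p : MvPolynomial (Fin n) K, constantCoeff ((lop (diagonal N) i ^ k) p) =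
      N i ^ k * k.factorial * coeff (Finsupp.single i k) p := by
  induction k with
  | zero => intro p; simp [constantCoeff_eq]
  | succ k ih =>
    intro p
    rw [pow_succ, Module.End.mul_apply, ih, lop_diagonal, coeff_smul, coeff_pderiv,
      ← Finsupp.single_add, Nat.factorial_succ, Finsupp.single_eq_same]
    simp
    ring

theorem contraction_quad (hN : ∀ i, N i ≠ 0)
    {θ : MvPolynomial (Fin n) K →ₐ[K] Module.End K (MvPolynomial (Fin n) K)}
    (hθ : ∀ i, θ (X i) = lop (diagonal N) i) (p : MvPolynomial (Fin n) K) :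
    θ (quad N) p = lapOp (diagonal N) p := by
  simp only [quad, map_smul, map_sum, map_mul, hθ, lapOp_diagonal, LinearMap.smul_apply,
    LinearMap.sum_apply, Module.End.mul_apply, lop_diagonal]
  congr 1
  refine Finset.sum_congr rfl fun i _ => ?_
  rw [smul_smul, inv_mul_cancel₀ (hN i), one_smul]

/-- A zonal harmonic represents the coefficient of `X i₀ ^ d` on harmonic polynomials. -/
theorem bd_zonal (hN : ∀ i, N i ≠ 0) (i₀ : Fin n) (d : ℕ) {p s : MvPolynomial (Fin n) K}
    (hp : p ∈ harm (diagonal N) d) :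
    bd (diagonal N) d p (X i₀ ^ d - quad N * s) =
      (-1) ^ d * (N i₀ ^ d * d.factorial * coeff (Finsupp.single i₀ d) p) := by
  obtain ⟨θ, hθ⟩ := exists_contraction (diagonal N)
  rw [bd_eq hθ, ← constantCoeff_lop_pow, mul_comm (quad N), map_sub, map_mul, map_pow, hθ,
    LinearMap.sub_apply, Module.End.mul_apply, contraction_quad hN hθ, hp.2, map_zero, sub_zero]

theorem bd_smul_left (B : Matrix (Fin n) (Fin n) K) (d : ℕ) (c : K)
    (p q : MvPolynomial (Fin n) K) : bd B d (c • p) q = c * bd B d p q := by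
  obtain ⟨θ, hθ⟩ := exists_contraction B
  rw [bd_eq hθ, bd_eq hθ, map_smul, constantCoeff_smul, smul_eq_mul]
  ring

theorem bd_smul_right (B : Matrix (Fin n) (Fin n) K) (d : ℕ) (c : K)
    (p q : MvPolynomial (Fin n) K) : bd B d p (c • q) = c * bd B d p q := by
  obtain ⟨θ, hθ⟩ := exists_contraction B
  rw [bd_eq hθ, bd_eq hθ, map_smul, LinearMap.smul_apply, constantCoeff_smul, smul_eq_mul]
  ring

theorem rot_mem_harm [CharZero K] (i j : Fin n) {d : ℕ} {p : MvPolynomial (Fin n) K}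
    (hp : p ∈ harm (diagonal N) d) : rot N i j p ∈ harm (diagonal N) d := by
  refine ⟨?_, by rw [lapOp_rot, hp.2, map_zero]⟩
  have h : ∀ a b : Fin n, (X a * pderiv b p).IsHomogeneous d := by
    intro a b
    cases d with
    | zero =>
      rw [pderiv_eq_zero_of_isHomogeneous_zero hp.1, mul_zero]
      exact isHomogeneous_zero _ _ _
    | succ d =>
      rw [add_comm]
      exact (isHomogeneous_X K a).mul hp.1.pderiv
  rw [rot_apply]
  exact (homogeneousSubmodule (Fin n) K d).sub_mem (Submodule.smul_mem _ _ (h i j))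
    (Submodule.smul_mem _ _ (h j i))

/-- For a diagonal form, an isometry of harmonic polynomials commuting with rotations is `±1`. -/
theorem eq_or_eq_neg_of_diagonal [CharZero K] (hn : 3 ≤ n) (hN : ∀ i, N i ≠ 0) {d : ℕ}
    (g : harm (diagonal N) d ≃ₗ[K] harm (diagonal N) d)
    (hcomm : ∀ i j, ∀ p p' : harm (diagonal N) d,
      (p' : MvPolynomial (Fin n) K) = rot N i j (p : MvPolynomial (Fin n) K) →
        (g p' : MvPolynomial (Fin n) K) = rot N i j (g p : MvPolynomial (Fin n) K))
    (hform : ∀ p q : harm (diagonal N) d,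
      bd (diagonal N) d (g p : MvPolynomial (Fin n) K) (g q : MvPolynomial (Fin n) K)
        = bd (diagonal N) d (p : MvPolynomial (Fin n) K) (q : MvPolynomial (Fin n) K)) :
    (∀ p, g p = p) ∨ (∀ p, g p = -p) := by
  let i₀ : Fin n := ⟨0, by lia⟩
  obtain ⟨Z, hZ, hZinv, s, hZs⟩ := exists_zonal hN i₀ d
  have hbd : ∀ p : harm (diagonal N) d, bd (diagonal N) d p Z =
      (-1) ^ d * (N i₀ ^ d * d.factorial * coeff (Finsupp.single i₀ d) (p : MvPolynomial _ K)) :=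
    fun p => by rw [hZs]; exact bd_zonal hN i₀ d p.2
  have hκ : ∀ x : K, (-1) ^ d * (N i₀ ^ d * d.factorial * x) = 0 → x = 0 := by
    intro x hx
    have : (d.factorial : K) ≠ 0 := by exact_mod_cast d.factorial_ne_zero
    simpa [hN i₀, this] using hx
  by_cases hZ0 : Z = 0
  · left
    intro p
    have hz : ∀ r ∈ harm (diagonal N) d, r = 0 := fun r hr =>
      eq_zero_of_rot_mem hN (harm (diagonal N) d) (fun r hr => hr.1)
        (fun r hr j => rot_mem_harm _ _ hr) (i₀ := i₀)
        (fun r hr => hκ _ <| by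
          rw [← hbd ⟨r, hr⟩, hZ0, ← zero_smul K (0 : MvPolynomial (Fin n) K), bd_smul_right,
            zero_mul]) hr
    exact Subtype.ext ((hz _ (g p).2).trans (hz _ p.2).symm)
  set z := coeff (Finsupp.single i₀ d) Z with hzdef
  have hz0 : z ≠ 0 := fun h => hZ0 (eq_zero_of_rot_eq_zero hn hN hZ hZinv h)
  obtain ⟨f, hf⟩ := g.surjective ⟨Z, hZ⟩
  have hfinv : ∀ i j, i ≠ i₀ → j ≠ i₀ → rot N i j (f : MvPolynomial (Fin n) K) = 0 := by
    intro i j hi hj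
    have h := hcomm i j f ⟨_, rot_mem_harm i j f.2⟩ rfl
    rw [hf, hZinv i j hi hj, ZeroMemClass.coe_eq_zero] at h
    exact congrArg Subtype.val (g.map_eq_zero_iff.mp h)
  obtain ⟨c, hc⟩ : ∃ c : K, (f : MvPolynomial (Fin n) K) = c • Z := by
    refine ⟨coeff (Finsupp.single i₀ d) (f : MvPolynomial (Fin n) K) / z, sub_eq_zero.mp ?_⟩
    refine eq_zero_of_rot_eq_zero (i₀ := i₀) hn hN (Submodule.sub_mem _ f.2
      (Submodule.smul_mem _ _ hZ)) (fun i j hi hj => ?_) ?_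
    · rw [map_sub, Derivation.map_smul, hfinv i j hi hj, hZinv i j hi hj, smul_zero, sub_zero]
    · rw [coeff_sub, coeff_smul, ← hzdef, smul_eq_mul, div_mul_cancel₀ _ hz0, sub_self]
  have hcoeff : ∀ p, coeff (Finsupp.single i₀ d) (g p : MvPolynomial (Fin n) K) =
      c * coeff (Finsupp.single i₀ d) (p : MvPolynomial (Fin n) K) := by
    intro p
    have h := hform p f
    rw [hf, hc, bd_smul_right, hbd, hbd] at h
    rw [← sub_eq_zero]
    apply hκ
    linear_combination h
  let L : harm (diagonal N) d →ₗ[K] MvPolynomial (Fin n) K :=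
    (harm (diagonal N) d).subtype ∘ₗ g.toLinearMap - c • (harm (diagonal N) d).subtype
  have hL : ∀ r, L r = (g r : MvPolynomial (Fin n) K) - c • (r : MvPolynomial (Fin n) K) :=
    fun r => rfl
  have hL0 : ∀ p, L p = 0 := by
    intro p
    refine eq_zero_of_rot_mem hN (i₀ := i₀) (d := d) (LinearMap.range L) ?_ ?_ ?_ ⟨p, rfl⟩
    · rintro _ ⟨r, rfl⟩
      rw [hL]
      exact (g r).2.1.sub (Submodule.smul_mem (harm (diagonal N) d) c r.2).1
    · rintro _ ⟨r, rfl⟩ j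
      refine ⟨⟨_, rot_mem_harm i₀ j r.2⟩, ?_⟩
      rw [hL, hL, hcomm i₀ j r ⟨_, rot_mem_harm i₀ j r.2⟩ rfl, map_sub, Derivation.map_smul]
    · rintro _ ⟨r, rfl⟩
      rw [hL, coeff_sub, hcoeff, coeff_smul, smul_eq_mul, sub_self]
  have hgc : ∀ p, g p = c • p := fun p =>
    Subtype.ext (sub_eq_zero.mp ((hL p).symm.trans (hL0 p)))
  have hc2 : c * c = 1 := by
    have h := hform ⟨Z, hZ⟩ ⟨Z, hZ⟩
    simp only [hgc, Submodule.coe_smul, bd_smul_left, bd_smul_right] at h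
    have hne : bd (diagonal N) d Z Z ≠ 0 := fun h0 => hz0 (hκ _ ((hbd ⟨Z, hZ⟩).symm.trans h0))
    exact mul_right_cancel₀ hne (by linear_combination h)
  rcases mul_self_eq_one_iff.mp hc2 with rfl | rfl
  · exact Or.inl fun p => by rw [hgc, one_smul]
  · exact Or.inr fun p => by rw [hgc]; exact neg_one_smul K p

end Diagonal

section ChangeOfBasis

variable {K : Type*} [Field K] {n : ℕ}

/-- The algebra endomorphism sending each variable to the linear form given by a column of `P`. -/
noncomputable def linSubst (P : Matrix (Fin n) (Fin n) K) :
    MvPolynomial (Fin n) K →ₐ[K] MvPolynomial (Fin n) K :=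
  aeval fun i => ∑ k, P k i • X k

theorem linSubst_X (P : Matrix (Fin n) (Fin n) K) (i : Fin n) :
    linSubst P (X i) = ∑ k, P k i • X k := by
  simp [linSubst]

theorem linSubst_linSubst {P R : Matrix (Fin n) (Fin n) K} (h : P * R = 1)
    (p : MvPolynomial (Fin n) K) : linSubst P (linSubst R p) = p := by
  suffices (linSubst P).comp (linSubst R) = AlgHom.id K _ from DFunLike.congr_fun this p
  refine MvPolynomial.algHom_ext fun i => ?_
  simp only [AlgHom.comp_apply, linSubst_X, map_sum, map_smul, Finset.smul_sum, AlgHom.id_apply]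
  rw [Finset.sum_comm]
  simp only [smul_smul, ← Finset.sum_smul]
  have : ∀ k, ∑ l, R l i * P k l = (1 : Matrix (Fin n) (Fin n) K) k i := by
    intro k
    rw [← h, Matrix.mul_apply]
    exact Finset.sum_congr rfl fun l _ => mul_comm _ _
  simp [this, Matrix.one_apply]

theorem isHomogeneous_linSubst (P : Matrix (Fin n) (Fin n) K) {d : ℕ}
    {p : MvPolynomial (Fin n) K} (hp : p.IsHomogeneous d) : (linSubst P p).IsHomogeneous d := by
  have h := hp.aeval (n := 1) (fun i => ∑ k, P k i • (X k : MvPolynomial (Fin n) K)) fun i =>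
    (homogeneousSubmodule (Fin n) K 1).sum_mem fun k _ =>
      Submodule.smul_mem _ _ (isHomogeneous_X K k)
  rwa [one_mul] at h

theorem constantCoeff_linSubst (P : Matrix (Fin n) (Fin n) K) (p : MvPolynomial (Fin n) K) :
    constantCoeff (linSubst P p) = constantCoeff p := by
  induction p using MvPolynomial.induction_on with
  | C a => simp [linSubst]
  | add p q hp hq => simp [hp, hq]
  | mul_X p i hp => simp [linSubst_X]

theorem pderiv_linSubst (P : Matrix (Fin n) (Fin n) K) (k : Fin n) (p : MvPolynomial (Fin n) K) :
    pderiv k (linSubst P p) = ∑ i, P k i • linSubst P (pderiv i p) := by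
  induction p using MvPolynomial.induction_on with
  | C a => simp [linSubst]
  | add p q hp hq => simp [hp, hq, Finset.sum_add_distrib]
  | mul_X p j hp =>
    have hX : pderiv k (linSubst P (X j)) = C (P k j) := by
      simp [linSubst_X, pderiv_X, Pi.single_apply, smul_eq_C_mul]
    simp only [map_mul, pderiv_mul, map_add, hp, hX, smul_add, Finset.sum_add_distrib,
      Finset.sum_mul, smul_mul_assoc]
    simp [pderiv_X, Pi.single_apply, apply_ite, smul_eq_C_mul, mul_comm]

variable {P B M : Matrix (Fin n) (Fin n) K}

theorem sum_lop_linSubst (h : P.transpose * B * P = M) (i : Fin n) (p : MvPolynomial (Fin n) K) :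
    ∑ k, P k i • lop B k (linSubst P p) = linSubst P (lop M i p) := by
  simp only [lop_apply, pderiv_linSubst, map_sum, map_smul, Finset.smul_sum, smul_smul]
  have : ∀ a, M i a = ∑ k, ∑ l, P k i * (B k l * P l a) := by
    intro a
    rw [← h, Matrix.mul_assoc]
    simp [Matrix.mul_apply, Finset.mul_sum]
  simp only [this, Finset.sum_smul]
  conv_rhs => rw [Finset.sum_comm]
  refine Finset.sum_congr rfl fun k _ => ?_
  rw [Finset.sum_comm]

theorem lapOp_linSubst (h : P.transpose * B * P = M) (p : MvPolynomial (Fin n) K) :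
    lapOp B (linSubst P p) = linSubst P (lapOp M p) := by
  simp only [lapOp_apply, map_smul]
  congr 1
  have e : ∀ (B : Matrix (Fin n) (Fin n) K) (q : MvPolynomial (Fin n) K),
      ∑ i, ∑ j, B i j • pderiv i (pderiv j q) = ∑ i, lop B i (pderiv i q) := by
    intro B q
    simp only [lop_apply]
    simp only [pderiv_pderiv_comm _ _ q]
  rw [e, e, map_sum]
  simp only [pderiv_linSubst, map_sum, map_smul, ← sum_lop_linSubst h]
  exact Finset.sum_comm

theorem soOp_linSubst {A A' : Matrix (Fin n) (Fin n) K} (h : A * P = P * A')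
    (p : MvPolynomial (Fin n) K) : soOp A (linSubst P p) = linSubst P (soOp A' p) := by
  have h1 : ∀ i a, ∑ j, A i j * P j a = ∑ b, P i b * A' b a := by
    intro i a
    rw [← Matrix.mul_apply, h, Matrix.mul_apply]
  simp only [soOp_apply, pderiv_linSubst, map_sum, map_smul, map_mul, linSubst_X, Finset.mul_sum,
    Finset.sum_mul, Finset.smul_sum, mul_smul_comm, smul_mul_assoc, smul_smul]
  have hl : ∀ i, ∑ j, ∑ a, (A i j * P j a) • (X i * linSubst P (pderiv a p)) =
      ∑ a, ∑ b, (P i b * A' b a) • (X i * linSubst P (pderiv a p)) := by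
    intro i
    rw [Finset.sum_comm]
    simp only [← Finset.sum_smul, h1]
  simp only [hl]
  rw [Finset.sum_comm]
  conv_rhs => rw [Finset.sum_comm]
  refine Finset.sum_congr rfl fun a _ => ?_
  rw [Finset.sum_comm]
  simp only [mul_comm]

theorem bd_linSubst (h : P.transpose * B * P = M) (d : ℕ) (p q : MvPolynomial (Fin n) K) :
    bd B d (linSubst P p) (linSubst P q) = bd M d p q := by
  obtain ⟨θ, hθ⟩ := exists_contraction B
  obtain ⟨η, hη⟩ := exists_contraction M
  have key : ∀ q p, θ (linSubst P q) (linSubst P p) = linSubst P (η q p) := by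
    intro q
    induction q using MvPolynomial.induction_on with
    | C a =>
      intro p
      rw [← algebraMap_eq, AlgHom.commutes, AlgHom.commutes, AlgHom.commutes]
      simp [Module.algebraMap_end_apply]
    | add q r hq hr => intro p; simp [hq, hr]
    | mul_X q i hq =>
      intro p
      rw [map_mul, map_mul, map_mul, Module.End.mul_apply, Module.End.mul_apply, ← hq, hη,
        ← sum_lop_linSubst h, linSubst_X]
      simp only [map_sum, map_smul, hθ, LinearMap.sum_apply, LinearMap.smul_apply]
  rw [bd_eq hθ, bd_eq hη, key, constantCoeff_linSubst]

theorem linSubst_mem_harm (h : P.transpose * B * P = M) {d : ℕ} {p : MvPolynomial (Fin n) K}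
    (hp : p ∈ harm M d) : linSubst P p ∈ harm B d :=
  ⟨isHomogeneous_linSubst P hp.1, by rw [lapOp_linSubst h, hp.2, map_zero]⟩

/-- The isomorphism of harmonic spaces induced by a change of basis. -/
noncomputable def harmEquiv {R : Matrix (Fin n) (Fin n) K} (h : P.transpose * B * P = M)
    (hPR : P * R = 1) (hRP : R * P = 1) (d : ℕ) : harm M d ≃ₗ[K] harm B d :=
  LinearEquiv.ofLinearMap
    ((linSubst P).toLinearMap.restrict fun _ hp => linSubst_mem_harm h hp)
    ((linSubst R).toLinearMap.restrict fun _ hp => linSubst_mem_harm (M := B) (by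
      have ht : R.transpose * P.transpose = 1 := by
        rw [← Matrix.transpose_mul, hPR, Matrix.transpose_one]
      rw [← h, Matrix.mul_assoc, Matrix.mul_assoc, Matrix.mul_assoc, hPR, Matrix.mul_one,
        ← Matrix.mul_assoc, ht, Matrix.one_mul]) hp)
    (LinearMap.ext fun p => Subtype.ext (linSubst_linSubst hPR _))
    (LinearMap.ext fun p => Subtype.ext (linSubst_linSubst hRP _))

theorem harmEquiv_apply {R : Matrix (Fin n) (Fin n) K} (h : P.transpose * B * P = M)
    (hPR : P * R = 1) (hRP : R * P = 1) (d : ℕ) (p : harm M d) :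
    (harmEquiv h hPR hRP d p : MvPolynomial (Fin n) K) = linSubst P (p : MvPolynomial (Fin n) K) :=
  rfl

/-- A symmetric matrix is congruent to a diagonal one. -/
theorem exists_transpose_mul_mul_eq_diagonal [CharZero K] (hsym : ∀ i j, B i j = B j i) :
    ∃ (P R : Matrix (Fin n) (Fin n) K) (N : Fin n → K),
      P * R = 1 ∧ R * P = 1 ∧ P.transpose * B * P = diagonal N := by
  have hs : LinearMap.IsSymm (Matrix.toBilin' B) := ⟨fun x y => by
    change Matrix.toBilin' B x y = Matrix.toBilin' B y x
    simp only [Matrix.toBilin'_apply]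
    rw [Finset.sum_comm]
    refine Finset.sum_congr rfl fun i _ => Finset.sum_congr rfl fun j _ => ?_
    simp only [hsym j i]
    ring⟩
  let _ : Invertible (2 : K) := invertibleOfNonzero two_ne_zero
  obtain ⟨v', hv'⟩ := LinearMap.BilinForm.exists_orthogonal_basis (V := Fin n → K) hs
  let e : Fin (Module.finrank K (Fin n → K)) ≃ Fin n := finCongr (by simp)
  let v := v'.reindex e
  refine ⟨(Pi.basisFun K (Fin n)).toMatrix v, v.toMatrix (Pi.basisFun K (Fin n)),
    fun i => Matrix.toBilin' B (v i) (v i), Module.Basis.toMatrix_mul_toMatrix_flip _ _,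
    Module.Basis.toMatrix_mul_toMatrix_flip _ _, ?_⟩
  ext i j
  have hij : ((((Pi.basisFun K (Fin n)).toMatrix v).transpose * B *
      (Pi.basisFun K (Fin n)).toMatrix v) i j) = Matrix.toBilin' B (v i) (v j) := by
    rw [Matrix.toBilin'_apply, Matrix.mul_assoc]
    simp only [Matrix.mul_apply, Matrix.transpose_apply, Module.Basis.toMatrix_apply,
      Pi.basisFun_repr, Finset.mul_sum, mul_assoc]
  rw [hij]
  by_cases h : i = j
  · subst h; simp
  · rw [diagonal_apply_ne _ h]
    simp only [v, Module.Basis.reindex_apply]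
    exact hv' (fun h' => h (e.symm.injective h'))

end ChangeOfBasis

/-- Any invertible linear map of `Sym^{[d]} V` (for `(V,b)` nondegenerate of
dimension `≥ 3` over a field of characteristic zero, `d ≥ 1`) commuting with the action
of `so(V,b)` and preserving the form `b_[d]` acts as `+1` or `-1`. -/
theorem stmt8 {K : Type*} [Field K] [CharZero K] {n d : ℕ} (hn : 3 ≤ n) (hd : 1 ≤ d)
    (B : Matrix (Fin n) (Fin n) K) (hsym : ∀ i j, B i j = B j i) (hB : IsUnit B.det)
    (g : harm B d ≃ₗ[K] harm B d)
    (hcomm : ∀ A : Matrix (Fin n) (Fin n) K, A.transpose * B + B * A = 0 →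
      ∀ p p' : harm B d, (p' : MvPolynomial (Fin n) K) = soOp A (p : MvPolynomial (Fin n) K) →
        ((g p' : MvPolynomial (Fin n) K)) = soOp A ((g p : MvPolynomial (Fin n) K)))
    (hform : ∀ p q : harm B d,
      bd B d (g p : MvPolynomial (Fin n) K) (g q : MvPolynomial (Fin n) K)
        = bd B d (p : MvPolynomial (Fin n) K) (q : MvPolynomial (Fin n) K)) :
    (∀ p, g p = p) ∨ (∀ p, g p = -p) := by
  obtain ⟨P, R, N, hPR, hRP, hPB⟩ := exists_transpose_mul_mul_eq_diagonal hsym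
  have hN : ∀ i, N i ≠ 0 := by
    have hdet := congrArg Matrix.det hPB
    have hP : P.det ≠ 0 := fun h0 => by
      have := congrArg Matrix.det hPR
      simp [h0] at this
    have hne : (diagonal N).det ≠ 0 := by
      rw [← hdet, Matrix.det_mul, Matrix.det_mul, Matrix.det_transpose]
      exact mul_ne_zero (mul_ne_zero hP hB.ne_zero) hP
    rw [Matrix.det_diagonal, Finset.prod_ne_zero_iff] at hne
    exact fun i => hne i (Finset.mem_univ i)
  let E := harmEquiv hPB hPR hRP d
  have hE : ∀ p, (E p : MvPolynomial (Fin n) K) = linSubst P (p : MvPolynomial (Fin n) K) :=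
    fun p => harmEquiv_apply hPB hPR hRP d p
  have hinj : Function.Injective (linSubst P) :=
    Function.LeftInverse.injective (linSubst_linSubst hRP)
  have hmain := eq_or_eq_neg_of_diagonal hn hN ((E.trans g).trans E.symm) (fun i j p p' hp => by
    obtain ⟨A', hA', hrot⟩ := exists_soOp_eq_rot N i j
    have hAP : P * A' * R * P = P * A' := by rw [Matrix.mul_assoc _ R P, hRP, Matrix.mul_one]
    have ht : R.transpose * P.transpose = 1 := by
      rw [← Matrix.transpose_mul, hPR, Matrix.transpose_one]
    have hA : (P * A' * R).transpose * B + B * (P * A' * R) = 0 := by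
      have hB' : B = R.transpose * diagonal N * R := by
        rw [← hPB, Matrix.mul_assoc, Matrix.mul_assoc, Matrix.mul_assoc, hPR, Matrix.mul_one,
          ← Matrix.mul_assoc, ht, Matrix.one_mul]
      calc (P * A' * R).transpose * B + B * (P * A' * R)
          = R.transpose * (A'.transpose * ((R * P).transpose * diagonal N)) * R +
            R.transpose * (diagonal N * ((R * P) * A')) * R := by
            rw [hB']
            simp only [Matrix.transpose_mul, Matrix.mul_assoc]
        _ = R.transpose * (A'.transpose * diagonal N + diagonal N * A') * R := by
            rw [hRP, Matrix.transpose_one, Matrix.one_mul, Matrix.one_mul, Matrix.mul_add,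
              Matrix.add_mul]
        _ = 0 := by rw [hA', Matrix.mul_zero, Matrix.zero_mul]
    have h := hcomm _ hA (E p) (E p') (by rw [hE, hE, hp, soOp_linSubst hAP, hrot])
    apply hinj
    rw [← hrot, ← soOp_linSubst hAP, ← hE, ← hE]
    simpa using h) (fun p q => by
    rw [← bd_linSubst hPB, ← bd_linSubst hPB, ← hE, ← hE, ← hE, ← hE,
      ← hform (E p) (E q)]
    simp)
  refine hmain.imp (fun h p => ?_) fun h p => ?_
  · have := congrArg E (h (E.symm p))
    simpa using this
  · have := congrArg E (h (E.symm p))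
    simpa using this
end
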